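/- arXiv:1601.05917 — 2 statements merged into one kernel-verified Lean document; each statement's English description precedes it below -/
import Mathlib

section
/- Let (V₁, V₂, S, X, Y₁, Y₂) be jointly distributed finite-valued random variables such that Y₁ is conditionally independent of (V₁,V₂) given (S,X), and Y₂ is conditionally independent of (V₁,V₂,S,X) given Y₁ (i.e., (V₁,V₂) → (S,X) → Y₁ → Y₂ forms a Markov chain). If I(V₂;Y₁|V₁) ≤ I(V₂;S|V₁), then I((V₁,V₂);Y₂) − I((V₁,V₂);S) ≤ I(V₁;Y₂) − I(V₁;S). -/
open scoped BigOperators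

noncomputable section

/-- A probability mass function on a finite type. -/
def IsPMF {α : Type*} [Fintype α] (p : α → ℝ) : Prop :=
  (∀ a, 0 ≤ p a) ∧ ∑ a, p a = 1

/-- Shannon entropy (base 2), with the convention `0 * log₂ 0 = 0`. -/
def ent {α : Type*} [Fintype α] (p : α → ℝ) : ℝ :=
  -∑ a, p a * Real.logb 2 (p a)

/-- Marginal of a joint pmf on the second component. -/
def margSnd {α β : Type*} [Fintype α] [Fintype β] (p : α × β → ℝ) : β → ℝ :=
  fun b => ∑ a, p (a, b)

/-- Marginal of a joint pmf on the first component. -/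
def margFst {α β : Type*} [Fintype α] [Fintype β] (p : α × β → ℝ) : α → ℝ :=
  fun a => ∑ b, p (a, b)

/-- Conditional entropy H(X|Y) of a joint pmf on α × β
(terms with `p (a, b) = 0` vanish since `0 * log₂ _ = 0`). -/
def condEnt {α β : Type*} [Fintype α] [Fintype β] (p : α × β → ℝ) : ℝ :=
  -∑ a, ∑ b, p (a, b) * Real.logb 2 (p (a, b) / margSnd p b)

/-- Mutual information I(X;Y) = H(X) - H(X|Y) of a joint pmf on α × β. -/
def mutInfo {α β : Type*} [Fintype α] [Fintype β] (p : α × β → ℝ) : ℝ :=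
  ent (margFst p) - condEnt p

/-- Pushforward of a pmf along a map. -/
def pushPMF {α β : Type*} [Fintype α] [DecidableEq β] (p : α → ℝ) (f : α → β) : β → ℝ :=
  fun b => ∑ a, if f a = b then p a else 0

/-- Entropy H(A) of a random variable A on the finite probability space (Ω, p). -/
def entOf {Ω α : Type*} [Fintype Ω] [Fintype α] [DecidableEq α] (p : Ω → ℝ) (A : Ω → α) : ℝ :=
  ent (pushPMF p A)

/-- Conditional entropy H(A|B) of random variables on (Ω, p). -/
def condEntOf {Ω α β : Type*} [Fintype Ω] [Fintype α] [Fintype β] [DecidableEq α] [DecidableEq β]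
    (p : Ω → ℝ) (A : Ω → α) (B : Ω → β) : ℝ :=
  condEnt (pushPMF p (fun ω => (A ω, B ω)))

/-- Mutual information I(A;B) of random variables on (Ω, p). -/
def mutInfoOf {Ω α β : Type*} [Fintype Ω] [Fintype α] [Fintype β] [DecidableEq α] [DecidableEq β]
    (p : Ω → ℝ) (A : Ω → α) (B : Ω → β) : ℝ :=
  entOf p A - condEntOf p A B

/-- Conditional mutual information I(A;B|C) = H(A|C) - H(A|(B,C)). -/
def condMutInfoOf {Ω α β γ : Type*} [Fintype Ω] [Fintype α] [Fintype β] [Fintype γ]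
    [DecidableEq α] [DecidableEq β] [DecidableEq γ]
    (p : Ω → ℝ) (A : Ω → α) (B : Ω → β) (C : Ω → γ) : ℝ :=
  condEntOf p A C - condEntOf p A (fun ω => (B ω, C ω))

/-- Bhattacharyya parameter Z(X|Y) = 2 ∑_y √(p(0,y) p(1,y)) for binary X. -/
def bhat {β : Type*} [Fintype β] (p : ZMod 2 × β → ℝ) : ℝ :=
  2 * ∑ b, Real.sqrt (p (0, b) * p (1, b))

/-- Conditional independence of `A` and `B` given `C` under the pmf `p`:
`p(a,b,c)·p_C(c) = p_{A,C}(a,c)·p_{B,C}(b,c)` for all `a`, `b`, `c`. -/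
def CondIndepOf {Ω α β γ : Type*} [Fintype Ω] [DecidableEq α] [DecidableEq β]
    [DecidableEq γ] (p : Ω → ℝ) (A : Ω → α) (B : Ω → β) (C : Ω → γ) : Prop :=
  ∀ (a : α) (b : β) (c : γ),
    pushPMF p (fun ω => (A ω, B ω, C ω)) (a, b, c) * pushPMF p C c
      = pushPMF p (fun ω => (A ω, C ω)) (a, c) * pushPMF p (fun ω => (B ω, C ω)) (b, c)

section Entropy

variable {Ω α β γ δ : Type*} [Fintype Ω]

lemma pushPMF_nonneg [DecidableEq α] {p : Ω → ℝ} (hp : ∀ ω, 0 ≤ p ω) (A : Ω → α) (a : α) :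
    0 ≤ pushPMF p A a :=
  Finset.sum_nonneg fun ω _ => by split_ifs <;> simp [hp ω]

lemma le_pushPMF_apply [DecidableEq α] {p : Ω → ℝ} (hp : ∀ ω, 0 ≤ p ω) (A : Ω → α) (ω : Ω) :
    p ω ≤ pushPMF p A (A ω) := by
  have := Finset.single_le_sum (f := fun ω' => if A ω' = A ω then p ω' else 0)
    (fun ω' _ => by split_ifs <;> simp [hp ω']) (Finset.mem_univ ω)
  simpa [pushPMF] using this

/-- Change of variables for the pushforward of a pmf. -/
lemma sum_pushPMF_mul [Fintype α] [DecidableEq α] (p : Ω → ℝ) (A : Ω → α) (f : α → ℝ) :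
    ∑ a, pushPMF p A a * f a = ∑ ω, p ω * f (A ω) := by
  simp only [pushPMF, Finset.sum_mul]
  rw [Finset.sum_comm]
  simp [ite_mul]

lemma sum_pushPMF [Fintype α] [DecidableEq α] (p : Ω → ℝ) (A : Ω → α) :
    ∑ a, pushPMF p A a = ∑ ω, p ω := by
  simpa using sum_pushPMF_mul p A fun _ => 1

lemma sum_pushPMF_prodMk [Fintype α] [DecidableEq α] [DecidableEq β] (p : Ω → ℝ) (A : Ω → α)
    (B : Ω → β) (b : β) :
    ∑ a, pushPMF p (fun ω => (A ω, B ω)) (a, b) = pushPMF p B b := by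
  simp only [pushPMF, Prod.mk.injEq, ite_and]
  rw [Finset.sum_comm]
  simp

lemma entOf_eq_sum [Fintype α] [DecidableEq α] (p : Ω → ℝ) (A : Ω → α) :
    entOf p A = -∑ ω, p ω * Real.logb 2 (pushPMF p A (A ω)) := by
  rw [entOf, ent, sum_pushPMF_mul p A fun a => Real.logb 2 (pushPMF p A a)]

/-- Entropy depends only on the partition induced by the random variable. -/
lemma entOf_congr [Fintype α] [Fintype β] [DecidableEq α] [DecidableEq β] (p : Ω → ℝ)
    {A : Ω → α} {B : Ω → β} (h : ∀ ω ω', A ω = A ω' ↔ B ω = B ω') :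
    entOf p A = entOf p B := by
  simp only [entOf_eq_sum, pushPMF, h]

/-- Chain rule for entropy. -/
lemma condEntOf_eq_sub [Fintype α] [Fintype β] [DecidableEq α] [DecidableEq β] {p : Ω → ℝ}
    (hp : ∀ ω, 0 ≤ p ω) (A : Ω → α) (B : Ω → β) :
    condEntOf p A B = entOf p (fun ω => (A ω, B ω)) - entOf p B := by
  have hmarg : margSnd (pushPMF p fun ω => (A ω, B ω)) = pushPMF p B :=
    funext fun b => sum_pushPMF_prodMk p A B b
  rw [condEntOf, condEnt, hmarg, ← Fintype.sum_prod_type'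
    (f := fun a b => pushPMF p (fun ω => (A ω, B ω)) (a, b) *
      Real.logb 2 (pushPMF p (fun ω => (A ω, B ω)) (a, b) / pushPMF p B b))]
  rw [sum_pushPMF_mul p (fun ω => (A ω, B ω)) fun x => Real.logb 2
    (pushPMF p (fun ω => (A ω, B ω)) (x.1, x.2) / pushPMF p B x.2),
    entOf_eq_sum, entOf_eq_sum, neg_sub_neg, neg_eq_iff_eq_neg, neg_sub, ← Finset.sum_sub_distrib]
  refine Finset.sum_congr rfl fun ω _ => ?_
  rcases (hp ω).eq_or_lt with h0 | hpos
  · simp [← h0]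
  · rw [Real.logb_div (hpos.trans_le (le_pushPMF_apply hp (fun ω => (A ω, B ω)) ω)).ne'
      (hpos.trans_le (le_pushPMF_apply hp B ω)).ne', mul_sub]

/-- Entropy form of conditional independence. -/
lemma CondIndepOf.entOf_add_entOf [Fintype α] [Fintype β] [Fintype γ] [DecidableEq α]
    [DecidableEq β] [DecidableEq γ] {p : Ω → ℝ} (hp : ∀ ω, 0 ≤ p ω) {A : Ω → α} {B : Ω → β}
    {C : Ω → γ} (h : CondIndepOf p A B C) :
    entOf p (fun ω => (A ω, B ω, C ω)) + entOf p C
      = entOf p (fun ω => (A ω, C ω)) + entOf p (fun ω => (B ω, C ω)) := by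
  simp only [entOf_eq_sum, ← neg_add, ← Finset.sum_add_distrib]
  congr 1
  refine Finset.sum_congr rfl fun ω _ => ?_
  rcases (hp ω).eq_or_lt with h0 | hpos
  · simp [← h0]
  have key := h (A ω) (B ω) (C ω)
  have hABC := (hpos.trans_le (le_pushPMF_apply hp (fun ω => (A ω, B ω, C ω)) ω)).ne'
  have hC := (hpos.trans_le (le_pushPMF_apply hp C ω)).ne'
  have hAC := (hpos.trans_le (le_pushPMF_apply hp (fun ω => (A ω, C ω)) ω)).ne'
  have hBC := (hpos.trans_le (le_pushPMF_apply hp (fun ω => (B ω, C ω)) ω)).ne'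
  rw [← mul_add, ← mul_add, ← Real.logb_mul hABC hC, ← Real.logb_mul hAC hBC, key]

/-- The conditionally independent coupling of `(A, C)` and `(B, C)` has the mass of `p`. -/
lemma sum_pushPMF_mul_pushPMF_div [Fintype α] [Fintype β] [Fintype γ] [DecidableEq α]
    [DecidableEq β] [DecidableEq γ] (p : Ω → ℝ) (A : Ω → α) (B : Ω → β) (C : Ω → γ) :
    ∑ x : α × β × γ, pushPMF p (fun ω => (A ω, C ω)) (x.1, x.2.2) *
      pushPMF p (fun ω => (B ω, C ω)) x.2 / pushPMF p C x.2.2 = ∑ ω, p ω := by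
  rw [Fintype.sum_prod_type_right, Fintype.sum_prod_type_right]
  simp only [← Finset.sum_div, ← Finset.sum_mul, ← Finset.mul_sum, sum_pushPMF_prodMk,
    mul_self_div_self, sum_pushPMF]

/-- Submodularity of entropy, i.e. nonnegativity of conditional mutual information. -/
lemma entOf_submodular [Fintype α] [Fintype β] [Fintype γ] [DecidableEq α] [DecidableEq β]
    [DecidableEq γ] {p : Ω → ℝ} (hp : ∀ ω, 0 ≤ p ω) (A : Ω → α) (B : Ω → β) (C : Ω → γ) :
    entOf p (fun ω => (A ω, B ω, C ω)) + entOf p C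
      ≤ entOf p (fun ω => (A ω, C ω)) + entOf p (fun ω => (B ω, C ω)) := by
  set P := pushPMF p (fun ω => (A ω, B ω, C ω)) with hP
  set R : α × β × γ → ℝ := fun x => pushPMF p (fun ω => (A ω, C ω)) (x.1, x.2.2) *
    pushPMF p (fun ω => (B ω, C ω)) x.2 / pushPMF p C x.2.2 with hR
  have hRnn (x) : 0 ≤ R x := div_nonneg
    (mul_nonneg (pushPMF_nonneg hp _ _) (pushPMF_nonneg hp _ _)) (pushPMF_nonneg hp _ _)
  have hmass : ∑ ω, p ω * (R (A ω, B ω, C ω) / P (A ω, B ω, C ω)) ≤ ∑ ω, p ω := by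
    rw [← sum_pushPMF_mul p (fun ω => (A ω, B ω, C ω)) fun x => R x / P x,
      ← sum_pushPMF_mul_pushPMF_div p A B C]
    refine Finset.sum_le_sum fun x _ => ?_
    by_cases hx : P x = 0
    · simpa [hx] using hRnn x
    · rw [← hP, mul_div_cancel₀ _ hx]
  have hlog : 0 < Real.log 2 := Real.log_pos one_lt_two
  have hterm (ω) : p ω * Real.logb 2 (pushPMF p (fun ω => (A ω, C ω)) (A ω, C ω)) +
      p ω * Real.logb 2 (pushPMF p (fun ω => (B ω, C ω)) (B ω, C ω)) -
      (p ω * Real.logb 2 (P (A ω, B ω, C ω)) + p ω * Real.logb 2 (pushPMF p C (C ω)))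
      ≤ (p ω * (R (A ω, B ω, C ω) / P (A ω, B ω, C ω)) - p ω) / Real.log 2 := by
    rcases (hp ω).eq_or_lt with h0 | hpos
    · simp [← h0]
    have hABC : 0 < P (A ω, B ω, C ω) :=
      hpos.trans_le (le_pushPMF_apply hp (fun ω => (A ω, B ω, C ω)) ω)
    have hC := hpos.trans_le (le_pushPMF_apply hp C ω)
    have hAC := hpos.trans_le (le_pushPMF_apply hp (fun ω => (A ω, C ω)) ω)
    have hBC := hpos.trans_le (le_pushPMF_apply hp (fun ω => (B ω, C ω)) ω)
    have hRpos : 0 < R (A ω, B ω, C ω) := div_pos (mul_pos hAC hBC) hC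
    have hle := Real.log_le_sub_one_of_pos (div_pos hRpos hABC)
    have heq : Real.log (R (A ω, B ω, C ω) / P (A ω, B ω, C ω)) =
        Real.log (pushPMF p (fun ω => (A ω, C ω)) (A ω, C ω)) +
        Real.log (pushPMF p (fun ω => (B ω, C ω)) (B ω, C ω)) -
        Real.log (pushPMF p C (C ω)) - Real.log (P (A ω, B ω, C ω)) := by
      rw [Real.log_div hRpos.ne' hABC.ne', hR,
        Real.log_div (mul_pos hAC hBC).ne' hC.ne', Real.log_mul hAC.ne' hBC.ne']
    rw [heq] at hle
    rw [le_div_iff₀ hlog]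
    calc _ = p ω * (Real.log (pushPMF p (fun ω => (A ω, C ω)) (A ω, C ω)) +
          Real.log (pushPMF p (fun ω => (B ω, C ω)) (B ω, C ω)) -
          Real.log (pushPMF p C (C ω)) - Real.log (P (A ω, B ω, C ω))) := by
          simp only [Real.logb]
          field_simp
          ring
      _ ≤ p ω * (R (A ω, B ω, C ω) / P (A ω, B ω, C ω) - 1) :=
          mul_le_mul_of_nonneg_left hle hpos.le
      _ = _ := by ring
  have hsum := Finset.sum_le_sum fun ω (_ : ω ∈ Finset.univ) => hterm ω
  rw [← Finset.sum_div, Finset.sum_sub_distrib, Finset.sum_sub_distrib, Finset.sum_add_distrib,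
    Finset.sum_add_distrib] at hsum
  have := hsum.trans (div_nonpos_of_nonpos_of_nonneg (sub_nonpos.2 hmass) hlog.le)
  simp only [entOf_eq_sum]
  linarith

/-- If `A` and `B` are conditionally independent given `C`, then `H(A|C) ≤ H(A|(D,C))` for every
function `D` of `B`. -/
lemma CondIndepOf.entOf_add_entOf_le [Fintype α] [Fintype β] [Fintype γ] [Fintype δ]
    [DecidableEq α] [DecidableEq β] [DecidableEq γ] [DecidableEq δ] {p : Ω → ℝ}
    (hp : ∀ ω, 0 ≤ p ω) {A : Ω → α} {B : Ω → β} {C : Ω → γ} {D : Ω → δ}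
    (h : CondIndepOf p A B C) (hD : ∀ ω ω', B ω = B ω' → D ω = D ω') :
    entOf p (fun ω => (A ω, C ω)) + entOf p (fun ω => (D ω, C ω))
      ≤ entOf p (fun ω => (A ω, D ω, C ω)) + entOf p C := by
  have hCI := h.entOf_add_entOf hp
  have hsub := entOf_submodular hp A B (fun ω => (D ω, C ω))
  have hABDC : entOf p (fun ω => (A ω, B ω, D ω, C ω)) = entOf p (fun ω => (A ω, B ω, C ω)) :=
    entOf_congr p fun ω ω' => by
      have := hD ω ω'
      simp only [Prod.mk.injEq]
      tauto
  have hBDC : entOf p (fun ω => (B ω, D ω, C ω)) = entOf p (fun ω => (B ω, C ω)) :=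
    entOf_congr p fun ω ω' => by
      have := hD ω ω'
      simp only [Prod.mk.injEq]
      tauto
  linarith

end Entropy

/-- if `(V₁,V₂) → (S,X) → Y₁ → Y₂` is a Markov chain and
`I(V₂;Y₁|V₁) ≤ I(V₂;S|V₁)`, then
`I((V₁,V₂);Y₂) − I((V₁,V₂);S) ≤ I(V₁;Y₂) − I(V₁;S)`. -/
theorem aux_reduction_inequality
    {Ω T1 T2 Ts Tx U1 U2 : Type*} [Fintype Ω] [Fintype T1] [Fintype T2] [Fintype Ts]
    [Fintype Tx] [Fintype U1] [Fintype U2] [DecidableEq T1] [DecidableEq T2]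
    [DecidableEq Ts] [DecidableEq Tx] [DecidableEq U1] [DecidableEq U2]
    (q : Ω → ℝ) (hq : IsPMF q)
    (V1 : Ω → T1) (V2 : Ω → T2) (S : Ω → Ts) (X : Ω → Tx) (Y1 : Ω → U1) (Y2 : Ω → U2)
    (hmc1 : CondIndepOf q Y1 (fun ω => (V1 ω, V2 ω)) (fun ω => (S ω, X ω)))
    (hmc2 : CondIndepOf q Y2 (fun ω => (V1 ω, V2 ω, S ω, X ω)) Y1)
    (h : condMutInfoOf q V2 Y1 V1 ≤ condMutInfoOf q V2 S V1) :
    mutInfoOf q (fun ω => (V1 ω, V2 ω)) Y2 - mutInfoOf q (fun ω => (V1 ω, V2 ω)) S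
      ≤ mutInfoOf q V1 Y2 - mutInfoOf q V1 S := by
  have hp := hq.1
  have hY1 := entOf_submodular hp Y2 V1 Y1
  have hCI := hmc2.entOf_add_entOf_le (D := fun ω => (V1 ω, V2 ω)) hp fun ω ω' => by
    simp only [Prod.mk.injEq]; tauto
  have hY2 := entOf_submodular hp V2 Y1 (fun ω => (V1 ω, Y2 ω))
  have hV2Y1Y2 : entOf q (fun ω => (V2 ω, Y1 ω, V1 ω, Y2 ω)) =
      entOf q (fun ω => (Y2 ω, (V1 ω, V2 ω), Y1 ω)) :=
    entOf_congr q fun ω ω' => by simp only [Prod.mk.injEq]; tauto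
  have hY1Y2 : entOf q (fun ω => (Y1 ω, V1 ω, Y2 ω)) =
      entOf q (fun ω => (Y2 ω, V1 ω, Y1 ω)) :=
    entOf_congr q fun ω ω' => by simp only [Prod.mk.injEq]; tauto
  have hV2Y2 : entOf q (fun ω => (V2 ω, V1 ω, Y2 ω)) =
      entOf q (fun ω => ((V1 ω, V2 ω), Y2 ω)) :=
    entOf_congr q fun ω ω' => by simp only [Prod.mk.injEq]; tauto
  have hV2Y1 : entOf q (fun ω => (V2 ω, Y1 ω, V1 ω)) =
      entOf q (fun ω => ((V1 ω, V2 ω), Y1 ω)) :=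
    entOf_congr q fun ω ω' => by simp only [Prod.mk.injEq]; tauto
  have hV2S : entOf q (fun ω => (V2 ω, S ω, V1 ω)) =
      entOf q (fun ω => ((V1 ω, V2 ω), S ω)) :=
    entOf_congr q fun ω ω' => by simp only [Prod.mk.injEq]; tauto
  have hV1Y1 : entOf q (fun ω => (Y1 ω, V1 ω)) =
      entOf q (fun ω => (V1 ω, Y1 ω)) :=
    entOf_congr q fun ω ω' => by simp only [Prod.mk.injEq]; tauto
  have hV1S : entOf q (fun ω => (S ω, V1 ω)) =
      entOf q (fun ω => (V1 ω, S ω)) :=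
    entOf_congr q fun ω ω' => by simp only [Prod.mk.injEq]; tauto
  simp only [condMutInfoOf, condEntOf_eq_sub hp] at h
  simp only [mutInfoOf, condEntOf_eq_sub hp]
  linarith
end
end

section
/- Consider a discrete memoryless channel with noncausal state (finite sets X, S, Y, state pmf P_S, channel W(y|x,s)). Let V be {0,1}-valued with conditional pmf P_{V|S}, let f : {0,1} × S → X, and let (V,S,Y) have joint pmf P_S(s)·P_{V|S}(v|s)·W(y| f(v,s), s). Assume I(V;Y) − I(V;S) > 0 and fix β ∈ (0,1/2). Then for every δ > 0 there exist a block length n and an (M,n) code such that (log₂ M)/n ≥ I(V;Y) − I(V;S) − δ and the error probability satisfies P_e ≤ 2^{−n^β}. -/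
open scoped BigOperators

noncomputable section

/-- Average error probability of an (M,n) code for a discrete memoryless channel
with noncausal state: the message is uniform on [M], the state sequence is i.i.d.
∼ PS and independent of the message, and the channel is memoryless. -/
def PeGP {Xc Sc Yc : Type*} [Fintype Xc] [Fintype Sc] [Fintype Yc]
    (PS : Sc → ℝ) (W : Xc → Sc → Yc → ℝ) {M n : ℕ}
    (enc : Fin M → (Fin n → Sc) → Fin n → Xc) (dec : (Fin n → Yc) → Fin M) : ℝ :=
  (1 / (M : ℝ)) * ∑ m : Fin M, ∑ s : Fin n → Sc, ∑ y : Fin n → Yc,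
    (∏ i, PS (s i)) * (∏ i, W (enc m s i) (s i) (y i)) *
      (if dec y ≠ m then 1 else 0)

namespace GelfandPinsker

section RandomCodebook

variable {κ α : Type*} [Fintype κ] [Fintype α] [DecidableEq κ] {P : α → ℝ}

/-- Expectation of a product of functions of two distinct entries of an i.i.d. codebook. -/
lemma sum_codebook_mul (hP : ∑ a, P a = 1) {k j : κ} (hkj : k ≠ j) (g h : α → ℝ) :
    ∑ u : κ → α, (∏ i, P (u i)) * (g (u k) * h (u j)) =
      (∑ a, P a * g a) * ∑ a, P a * h a := by
  let F : κ → α → ℝ := fun i a =>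
    P a * ((if i = k then g a else 1) * (if i = j then h a else 1))
  have hF : ∀ u : κ → α, (∏ i, P (u i)) * (g (u k) * h (u j)) = ∏ i, F i (u i) := by
    intro u
    simp only [F, Finset.prod_mul_distrib]
    simp
  simp_rw [hF]
  rw [← Fintype.prod_sum]
  have hsum : ∀ i, ∑ a, F i a =
      (if i = k then ∑ a, P a * g a else 1) * (if i = j then ∑ a, P a * h a else 1) := by
    intro i
    by_cases hik : i = k
    · simp [F, hik, hkj]
    · by_cases hij : i = j
      · simp [F, hij, hkj.symm]
      · simp [F, hik, hij, hP]
  simp_rw [hsum, Finset.prod_mul_distrib]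
  simp

/-- Expectation of a function of one entry of an i.i.d. codebook. -/
lemma sum_codebook (hP : ∑ a, P a = 1) (k : κ) (g : α → ℝ) :
    ∑ u : κ → α, (∏ i, P (u i)) * g (u k) = ∑ a, P a * g a := by
  let F : κ → α → ℝ := fun i a => P a * (if i = k then g a else 1)
  have hF : ∀ u : κ → α, (∏ i, P (u i)) * g (u k) = ∏ i, F i (u i) := by
    intro u
    simp only [F, Finset.prod_mul_distrib]
    simp
  simp_rw [hF]
  rw [← Fintype.prod_sum]
  have hsum : ∀ i, ∑ a, F i a = if i = k then ∑ a, P a * g a else 1 := by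
    intro i
    by_cases hik : i = k <;> simp [F, hik, hP]
  simp [hsum]

lemma sum_codebook_weight (hP : ∑ a, P a = 1) : ∑ u : κ → α, ∏ i, P (u i) = 1 := by
  rw [← Fintype.prod_sum]
  simp [hP]

/-- Second moment of the empirical mean over a part of the codebook. -/
lemma sum_codebook_sq_mean_sub_le (hP : ∑ a, P a = 1)
    (B : Finset κ) (hB : B.Nonempty) (X : α → ℝ) :
    ∑ u : κ → α, (∏ i, P (u i)) * ((∑ k ∈ B, X (u k)) / B.card - ∑ a, P a * X a) ^ 2 ≤
      (∑ a, P a * X a ^ 2) / B.card := by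
  set μ := ∑ a, P a * X a with hμ
  have hc : (0 : ℝ) < B.card := by exact_mod_cast hB.card_pos
  have hzero : ∑ a, P a * (X a - μ) = 0 := by
    simp only [mul_sub, Finset.sum_sub_distrib, ← Finset.sum_mul, hP, one_mul]
    rw [← hμ, sub_self]
  have hvar : ∑ a, P a * ((X a - μ) * (X a - μ)) ≤ ∑ a, P a * X a ^ 2 := by
    have : ∑ a, P a * ((X a - μ) * (X a - μ)) = ∑ a, P a * X a ^ 2 - μ ^ 2 := by
      calc _ = ∑ a, (P a * X a ^ 2 - 2 * μ * (P a * X a) + μ ^ 2 * P a) :=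
            Finset.sum_congr rfl fun a _ => by ring
        _ = _ := by
            rw [Finset.sum_add_distrib, Finset.sum_sub_distrib, ← Finset.mul_sum,
              ← Finset.mul_sum, hP, ← hμ]
            ring
    rw [this]
    nlinarith [sq_nonneg μ]
  have hexp : ∀ u : κ → α,
      (∏ i, P (u i)) * ((∑ k ∈ B, X (u k)) / B.card - μ) ^ 2 =
      ((B.card : ℝ) ^ 2)⁻¹ *
        ∑ k ∈ B, ∑ j ∈ B, (∏ i, P (u i)) * ((X (u k) - μ) * (X (u j) - μ)) := by
    intro u
    have h1 : (∑ k ∈ B, X (u k)) / B.card - μ = (B.card : ℝ)⁻¹ * ∑ k ∈ B, (X (u k) - μ) := by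
      rw [Finset.sum_sub_distrib, Finset.sum_const, nsmul_eq_mul]
      field_simp
    simp_rw [← Finset.mul_sum]
    rw [← Finset.sum_mul, h1]
    ring
  simp_rw [hexp]
  rw [← Finset.mul_sum, Finset.sum_comm]
  have hk : ∀ k ∈ B, ∑ u : κ → α, ∑ j ∈ B,
      (∏ i, P (u i)) * ((X (u k) - μ) * (X (u j) - μ)) =
      ∑ a, P a * ((X a - μ) * (X a - μ)) := by
    intro k hk
    rw [Finset.sum_comm, Finset.sum_eq_single_of_mem k hk]
    · exact sum_codebook hP k fun a => (X a - μ) * (X a - μ)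
    · intro j _ hj
      rw [sum_codebook_mul hP hj.symm (fun a => X a - μ) fun a => X a - μ, hzero, zero_mul]
  rw [Finset.sum_congr rfl hk, Finset.sum_const, nsmul_eq_mul]
  calc _ = (∑ a, P a * ((X a - μ) * (X a - μ))) / B.card := by field_simp
    _ ≤ _ := by gcongr

/-- First absolute moment of the empirical mean over a part of the codebook. -/
lemma sum_codebook_abs_mean_sub_le (hP0 : ∀ a, 0 ≤ P a) (hP : ∑ a, P a = 1)
    (B : Finset κ) (hB : B.Nonempty) (X : α → ℝ) :
    ∑ u : κ → α, (∏ i, P (u i)) * |(∑ k ∈ B, X (u k)) / B.card - ∑ a, P a * X a| ≤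
      √((∑ a, P a * X a ^ 2) / B.card) := by
  refine Real.le_sqrt_of_sq_le (le_trans ?_ (sum_codebook_sq_mean_sub_le hP B hB X))
  have hw : ∀ u : κ → α, 0 ≤ ∏ i, P (u i) := fun u => Finset.prod_nonneg fun i _ => hP0 _
  have h := Finset.sum_sq_le_sum_mul_sum_of_sq_le_mul (Finset.univ : Finset (κ → α))
    (r := fun u => (∏ i, P (u i)) * |(∑ k ∈ B, X (u k)) / B.card - ∑ a, P a * X a|)
    (f := fun u => ∏ i, P (u i))
    (g := fun u => (∏ i, P (u i)) * ((∑ k ∈ B, X (u k)) / B.card - ∑ a, P a * X a) ^ 2)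
    (fun u _ => hw u) (fun u _ => mul_nonneg (hw u) (sq_nonneg _))
    (fun u _ => by rw [mul_pow, sq_abs]; exact le_of_eq (by ring))
  rwa [sum_codebook_weight hP, one_mul] at h

/-- Some codebook does at least as well as the average. -/
lemma exists_codebook_le (hP0 : ∀ a, 0 ≤ P a) (hP : ∑ a, P a = 1) (F : (κ → α) → ℝ) {B : ℝ}
    (hF : ∑ u : κ → α, (∏ i, P (u i)) * F u ≤ B) : ∃ u, F u ≤ B := by
  by_contra! hcon
  have hw : ∀ u : κ → α, 0 ≤ ∏ i, P (u i) := fun u => Finset.prod_nonneg fun i _ => hP0 _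
  have hsum := sum_codebook_weight (κ := κ) hP
  obtain ⟨u, -, hu⟩ : ∃ u ∈ (Finset.univ : Finset (κ → α)), 0 < ∏ i, P (u i) :=
    Finset.exists_lt_of_sum_lt (by simp [hsum])
  have : ∑ u : κ → α, (∏ i, P (u i)) * B < ∑ u : κ → α, (∏ i, P (u i)) * F u :=
    Finset.sum_lt_sum (fun u _ => mul_le_mul_of_nonneg_left (hcon u).le (hw u))
      ⟨u, Finset.mem_univ _, mul_lt_mul_of_pos_left (hcon u) hu⟩
  rw [← Finset.sum_mul, hsum, one_mul] at this
  linarith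

end RandomCodebook

section OneShot

variable {κ α β : Type*} [Fintype κ] [Fintype α] [Fintype β] [DecidableEq κ]
  {P : α → ℝ} {T : α → β → ℝ} {R : β → ℝ}

/-- Soft covering: the output of the channel `T` driven by a uniformly chosen codeword from the
part `B` of a random codebook nearly dominates the output distribution `R`. -/
lemma soft_covering (hP0 : ∀ a, 0 ≤ P a) (hP : ∑ a, P a = 1) (hT : ∀ a y, 0 ≤ T a y)
    (hR : ∀ y, R y = ∑ a, P a * T a y) (hR1 : ∑ y, R y = 1)
    (B : Finset κ) (hB : B.Nonempty) {c : ℝ} (hc : 0 ≤ c) :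
    ∑ u : κ → α, (∏ i, P (u i)) * ∑ y, max (R y - (∑ k ∈ B, T (u k) y) / B.card) 0 ≤
      (∑ a, ∑ y, P a * T a y * (if c * R y < T a y then 1 else 0)) + √(c / B.card) := by
  have hw : ∀ u : κ → α, 0 ≤ ∏ i, P (u i) := fun u => Finset.prod_nonneg fun i _ => hP0 _
  have hR0 : ∀ y, 0 ≤ R y := fun y => by
    rw [hR]; exact Finset.sum_nonneg fun a _ => mul_nonneg (hP0 a) (hT a y)
  let X : β → α → ℝ := fun y a => if c * R y < T a y then 0 else T a y
  have hX0 : ∀ y a, 0 ≤ X y a := fun y a => by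
    simp only [X]; split_ifs <;> simp [hT]
  have hXT : ∀ y a, X y a ≤ T a y := fun y a => by
    simp only [X]; split_ifs <;> simp [hT]
  have hXc : ∀ y a, X y a ≤ c * R y := fun y a => by
    simp only [X]
    split_ifs with h
    · exact mul_nonneg hc (hR0 y)
    · exact not_lt.mp h
  have hmean : ∀ y, ∑ a, P a * X y a =
      R y - ∑ a, P a * T a y * (if c * R y < T a y then 1 else 0) := by
    intro y
    rw [hR y, ← Finset.sum_sub_distrib, ← hR y]
    refine Finset.sum_congr rfl fun a _ => ?_
    simp only [X]
    split_ifs <;> ring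
  have hmean_le : ∀ y, ∑ a, P a * X y a ≤ R y := fun y => by
    rw [hR]
    exact Finset.sum_le_sum fun a _ => mul_le_mul_of_nonneg_left (hXT y a) (hP0 a)
  have hsq : ∀ y, √((∑ a, P a * X y a ^ 2) / B.card) ≤ R y * √(c / B.card) := by
    intro y
    have : R y * √(c / B.card) = √(R y ^ 2 * (c / B.card)) := by
      rw [Real.sqrt_mul (sq_nonneg _), Real.sqrt_sq (hR0 y)]
    rw [this]
    refine Real.sqrt_le_sqrt ?_
    rw [← mul_div_assoc]
    gcongr
    calc ∑ a, P a * X y a ^ 2 ≤ ∑ a, (c * R y) * (P a * X y a) :=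
          Finset.sum_le_sum fun a _ => by
            nlinarith [mul_nonneg (mul_nonneg (hP0 a) (hX0 y a)) (sub_nonneg.mpr (hXc y a))]
      _ = (c * R y) * ∑ a, P a * X y a := by rw [Finset.mul_sum]
      _ ≤ (c * R y) * R y :=
          mul_le_mul_of_nonneg_left (hmean_le y) (mul_nonneg hc (hR0 y))
      _ = R y ^ 2 * c := by ring
  have hpt : ∀ (u : κ → α) y, max (R y - (∑ k ∈ B, T (u k) y) / B.card) 0 ≤
      (R y - ∑ a, P a * X y a) +
        |(∑ k ∈ B, X y (u k)) / B.card - ∑ a, P a * X y a| := by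
    intro u y
    have h1 : (∑ k ∈ B, X y (u k)) / B.card ≤ (∑ k ∈ B, T (u k) y) / B.card := by
      gcongr with k _
      exact hXT y (u k)
    have h2 := neg_abs_le ((∑ k ∈ B, X y (u k)) / B.card - ∑ a, P a * X y a)
    have h3 := abs_nonneg ((∑ k ∈ B, X y (u k)) / B.card - ∑ a, P a * X y a)
    have h4 := hmean_le y
    exact max_le (by linarith) (by linarith)
  calc _ ≤ ∑ u : κ → α, (∏ i, P (u i)) * ∑ y, ((R y - ∑ a, P a * X y a) +
          |(∑ k ∈ B, X y (u k)) / B.card - ∑ a, P a * X y a|) :=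
        Finset.sum_le_sum fun u _ => mul_le_mul_of_nonneg_left
          (Finset.sum_le_sum fun y _ => hpt u y) (hw u)
    _ = ∑ y, ∑ u : κ → α, ((∏ i, P (u i)) * (R y - ∑ a, P a * X y a) + (∏ i, P (u i)) *
          |(∑ k ∈ B, X y (u k)) / B.card - ∑ a, P a * X y a|) := by
        rw [Finset.sum_comm]
        simp_rw [Finset.mul_sum, mul_add]
    _ ≤ ∑ y, ((R y - ∑ a, P a * X y a) + R y * √(c / B.card)) := by
        refine Finset.sum_le_sum fun y _ => ?_
        rw [Finset.sum_add_distrib, ← Finset.sum_mul, sum_codebook_weight hP, one_mul]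
        gcongr
        exact (sum_codebook_abs_mean_sub_le hP0 hP B hB (X y)).trans (hsq y)
    _ = _ := by
        rw [Finset.sum_add_distrib, ← Finset.sum_mul, hR1, one_mul]
        congr 1
        rw [Finset.sum_comm]
        exact Finset.sum_congr rfl fun y _ => by rw [hmean]; ring

/-- Random coding bound for the probability that a maximum-likelihood decoder `D` fails to
recover the codeword with index `k`. -/
lemma random_coding (hP0 : ∀ a, 0 ≤ P a) (hP : ∑ a, P a = 1) (hT : ∀ a y, 0 ≤ T a y)
    (hR : ∀ y, R y = ∑ a, P a * T a y) (hR1 : ∑ y, R y = 1)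
    (hRT : ∀ y, R y = 0 → ∀ a, T a y = 0)
    (D : (κ → α) → β → κ) (hD : ∀ (u : κ → α) y k, T (u k) y ≤ T (u (D u y)) y)
    (k : κ) {c : ℝ} (hc : 0 < c) :
    ∑ u : κ → α, (∏ i, P (u i)) * ∑ y, T (u k) y * (if D u y ≠ k then 1 else 0) ≤
      (∑ a, ∑ y, P a * T a y * (if T a y < c * R y then 1 else 0)) + Fintype.card κ / c := by
  have hw : ∀ u : κ → α, 0 ≤ ∏ i, P (u i) := fun u => Finset.prod_nonneg fun i _ => hP0 _
  have hR0 : ∀ y, 0 ≤ R y := fun y => by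
    rw [hR]; exact Finset.sum_nonneg fun a _ => mul_nonneg (hP0 a) (hT a y)
  have hpt : ∀ (u : κ → α) y, T (u k) y * (if D u y ≠ k then 1 else 0) ≤
      T (u k) y * (if T (u k) y < c * R y then 1 else 0) +
        ∑ j ∈ Finset.univ.erase k, T (u k) y * T (u j) y / (c * R y) := by
    intro u y
    have hterm : ∀ j, 0 ≤ T (u k) y * T (u j) y / (c * R y) := fun j =>
      div_nonneg (mul_nonneg (hT _ _) (hT _ _)) (mul_nonneg hc.le (hR0 y))
    have hsum : 0 ≤ ∑ j ∈ Finset.univ.erase k, T (u k) y * T (u j) y / (c * R y) :=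
      Finset.sum_nonneg fun j _ => hterm j
    by_cases hDk : D u y = k
    · have : 0 ≤ T (u k) y * (if T (u k) y < c * R y then 1 else 0) :=
        mul_nonneg (hT _ _) (by split_ifs <;> norm_num)
      simp only [hDk, ne_eq, not_true_eq_false, if_false, mul_zero]
      linarith
    · by_cases hlt : T (u k) y < c * R y
      · simp only [ne_eq, hDk, not_false_eq_true, if_true, hlt, mul_one]
        linarith
      · simp only [ne_eq, hDk, not_false_eq_true, if_true, hlt, if_false, mul_one, mul_zero,
          zero_add]
        rcases (hR0 y).eq_or_lt with h0 | hpos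
        · rw [hRT y h0.symm (u k)]
          simp
        · refine le_trans ?_ (Finset.single_le_sum (fun j _ => hterm j)
            (Finset.mem_erase.mpr ⟨hDk, Finset.mem_univ (D u y)⟩))
          rw [le_div_iff₀ (mul_pos hc hpos)]
          exact mul_le_mul_of_nonneg_left ((not_lt.mp hlt).trans (hD u y k)) (hT _ _)
  calc _ ≤ ∑ u : κ → α, (∏ i, P (u i)) * ∑ y,
          (T (u k) y * (if T (u k) y < c * R y then 1 else 0) +
            ∑ j ∈ Finset.univ.erase k, T (u k) y * T (u j) y / (c * R y)) :=
        Finset.sum_le_sum fun u _ => mul_le_mul_of_nonneg_left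
          (Finset.sum_le_sum fun y _ => hpt u y) (hw u)
    _ = ∑ y, ((∑ u : κ → α, (∏ i, P (u i)) *
            (T (u k) y * (if T (u k) y < c * R y then 1 else 0))) +
          ∑ j ∈ Finset.univ.erase k, (∑ u : κ → α, (∏ i, P (u i)) *
            (T (u k) y * T (u j) y)) / (c * R y)) := by
        simp_rw [Finset.mul_sum, mul_add, Finset.mul_sum]
        rw [Finset.sum_comm]
        refine Finset.sum_congr rfl fun y _ => ?_
        rw [Finset.sum_add_distrib]
        congr 1
        rw [Finset.sum_comm]
        refine Finset.sum_congr rfl fun j _ => ?_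
        rw [Finset.sum_div]
        exact Finset.sum_congr rfl fun u _ => by ring
    _ ≤ ∑ y, ((∑ a, P a * T a y * (if T a y < c * R y then 1 else 0)) +
          Fintype.card κ / c * R y) := by
        refine Finset.sum_le_sum fun y _ => ?_
        rw [sum_codebook hP k fun a => T a y * (if T a y < c * R y then 1 else 0)]
        refine add_le_add (le_of_eq (Finset.sum_congr rfl fun a _ => by ring)) ?_
        have hj : ∀ j ∈ Finset.univ.erase k, (∑ u : κ → α, (∏ i, P (u i)) *
            (T (u k) y * T (u j) y)) / (c * R y) = R y / c := by
          intro j hj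
          rw [sum_codebook_mul hP (Finset.ne_of_mem_erase hj).symm (fun a => T a y)
            fun a => T a y, ← hR]
          rcases (hR0 y).eq_or_lt with h0 | hpos
          · simp [← h0]
          · field_simp
        rw [Finset.sum_congr rfl hj, Finset.sum_const, nsmul_eq_mul]
        have : ((Finset.univ.erase k).card : ℝ) ≤ Fintype.card κ := by
          exact_mod_cast Finset.card_le_univ _
        calc _ ≤ (Fintype.card κ : ℝ) * (R y / c) :=
              mul_le_mul_of_nonneg_right this (div_nonneg (hR0 y) hc.le)
          _ = _ := by ring
    _ = _ := by
        rw [Finset.sum_add_distrib, ← Finset.mul_sum, hR1, mul_one, Finset.sum_comm]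

/-- One-shot achievability for coding with noncausal state: `TS` and `TY` are the channels from
the auxiliary variable to the state and to the output, `N` is the channel to the output given
the auxiliary variable and the state. -/
lemma exists_code_one_shot {σ : Type*} [Fintype σ] {M L : ℕ} (hM : 0 < M) (hL : 0 < L)
    {N : α → σ → β → ℝ} {TS : α → σ → ℝ} {TY : α → β → ℝ} {RS : σ → ℝ} {RY : β → ℝ}
    (hP0 : ∀ a, 0 ≤ P a) (hP : ∑ a, P a = 1)
    (hN : ∀ a s y, 0 ≤ N a s y) (hN1 : ∀ a s, ∑ y, N a s y = 1)
    (hTS : ∀ a s, 0 ≤ TS a s) (hRS : ∀ s, RS s = ∑ a, P a * TS a s) (hRS1 : ∑ s, RS s = 1)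
    (hTY : ∀ a y, TY a y = ∑ s, TS a s * N a s y)
    (hRY : ∀ y, RY y = ∑ a, P a * TY a y) (hRY1 : ∑ y, RY y = 1)
    (hRT : ∀ y, RY y = 0 → ∀ a, TY a y = 0) {c d : ℝ} (hc : 0 ≤ c) (hd : 0 < d) :
    ∃ (enc : Fin M → σ → α) (dec : β → Fin M),
      (1 / (M : ℝ)) * ∑ m, ∑ s, ∑ y, RS s * N (enc m s) s y * (if dec y ≠ m then 1 else 0) ≤
        (∑ a, ∑ s, P a * TS a s * (if c * RS s < TS a s then 1 else 0)) + √(c / L) +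
        ((∑ a, ∑ y, P a * TY a y * (if TY a y < d * RY y then 1 else 0)) + M * L / d) := by
  have : NeZero M := ⟨hM.ne'⟩
  have : NeZero L := ⟨hL.ne'⟩
  have hTY0 : ∀ a y, 0 ≤ TY a y := fun a y => by
    rw [hTY]; exact Finset.sum_nonneg fun s _ => mul_nonneg (hTS a s) (hN a s y)
  choose D hD using fun (u : Fin M × Fin L → α) (y : β) =>
    Finite.exists_max fun k : Fin M × Fin L => TY (u k) y
  let e : (Fin M × Fin L → α) → Fin M → σ → Fin L → ℝ := fun u m s l =>
    ∑ y, N (u (m, l)) s y * (if (D u y).1 ≠ m then 1 else 0)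
  choose l hl using fun u m s => Finite.exists_min (e u m s)
  have he0 : ∀ u m s l, 0 ≤ e u m s l := fun u m s l =>
    Finset.sum_nonneg fun y _ => mul_nonneg (hN _ _ _) (by split_ifs <;> norm_num)
  have he1 : ∀ u m s l, e u m s l ≤ 1 := fun u m s l => by
    rw [← hN1 (u (m, l)) s]
    refine Finset.sum_le_sum fun y _ => mul_le_of_le_one_right (hN _ _ _) ?_
    split_ifs <;> norm_num
  let B : Fin M → Finset (Fin M × Fin L) := fun m =>
    Finset.univ.map ⟨Prod.mk m, Prod.mk_right_injective m⟩
  have hBcard : ∀ m, (B m).card = L := fun m => by simp [B]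
  have hB : ∀ m, (B m).Nonempty := fun m => by
    rw [← Finset.card_pos, hBcard]; exact hL
  let cov : (Fin M × Fin L → α) → Fin M → σ → ℝ := fun u m s =>
    max (RS s - (∑ k ∈ B m, TS (u k) s) / (B m).card) 0
  let F : (Fin M × Fin L → α) → ℝ := fun u => (1 / (M : ℝ)) * ∑ m, ((∑ s, cov u m s) +
    (1 / (L : ℝ)) * ∑ l, ∑ y, TY (u (m, l)) y * (if D u y ≠ (m, l) then 1 else 0))
  have havg : ∑ u : Fin M × Fin L → α, (∏ i, P (u i)) * F u ≤
      (∑ a, ∑ s, P a * TS a s * (if c * RS s < TS a s then 1 else 0)) + √(c / L) +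
        ((∑ a, ∑ y, P a * TY a y * (if TY a y < d * RY y then 1 else 0)) + M * L / d) := by
    have hcov := fun m => soft_covering hP0 hP hTS hRS hRS1 (B m) (hB m) hc
    have hcod := fun k => random_coding hP0 hP hTY0 hRY hRY1 hRT D (fun u y k => hD u y k) k hd
    simp only [Fintype.card_prod, Fintype.card_fin, Nat.cast_mul] at hcod
    have hswap : ∑ u : Fin M × Fin L → α, (∏ i, P (u i)) * F u =
        (1 / (M : ℝ)) * ∑ m, ((∑ u : Fin M × Fin L → α, (∏ i, P (u i)) * ∑ s, cov u m s) +
          (1 / (L : ℝ)) * ∑ l, ∑ u : Fin M × Fin L → α, (∏ i, P (u i)) *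
            ∑ y, TY (u (m, l)) y * (if D u y ≠ (m, l) then 1 else 0)) := by
      simp only [F]
      rw [Finset.mul_sum]
      simp_rw [fun (m : Fin M) => Finset.sum_comm (s := (Finset.univ : Finset (Fin L)))
        (t := (Finset.univ : Finset (Fin M × Fin L → α)))
        (f := fun l u => (∏ i, P (u i)) *
            ∑ y, TY (u (m, l)) y * (if D u y ≠ (m, l) then 1 else 0))]
      simp_rw [Finset.mul_sum (Finset.univ : Finset (Fin M × Fin L → α)),
        ← Finset.sum_add_distrib]
      rw [← Finset.mul_sum, Finset.sum_comm, Finset.mul_sum]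
      refine Finset.sum_congr rfl fun u _ => ?_
      rw [mul_left_comm, Finset.mul_sum]
      congr 1
      refine Finset.sum_congr rfl fun m _ => ?_
      rw [← Finset.mul_sum]
      ring
    rw [hswap]
    simp_rw [hBcard] at hcov
    refine (mul_le_mul_of_nonneg_left (Finset.sum_le_sum fun m _ => add_le_add
      (le_of_eq_of_le (by simp only [cov, hBcard]) (hcov m))
      (mul_le_mul_of_nonneg_left (Finset.sum_le_sum fun l _ => hcod (m, l)) (by positivity)))
      (by positivity)).trans (le_of_eq ?_)
    simp only [Finset.sum_const, Finset.card_univ, Fintype.card_fin, nsmul_eq_mul]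
    field_simp
  obtain ⟨u, hu⟩ := exists_codebook_le hP0 hP F havg
  refine ⟨fun m s => u (m, l u m s), fun y => (D u y).1, le_trans ?_ hu⟩
  simp only [F]
  refine mul_le_mul_of_nonneg_left (Finset.sum_le_sum fun m _ => ?_) (by positivity)
  have hTYe : ∀ l, ∑ s, TS (u (m, l)) s * e u m s l ≤
      ∑ y, TY (u (m, l)) y * (if D u y ≠ (m, l) then 1 else 0) := by
    intro l
    simp only [e, hTY, Finset.mul_sum, Finset.sum_mul]
    rw [Finset.sum_comm]
    refine Finset.sum_le_sum fun y _ => Finset.sum_le_sum fun s _ => ?_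
    rw [← mul_assoc]
    refine mul_le_mul_of_nonneg_left ?_ (mul_nonneg (hTS _ _) (hN _ _ _))
    by_cases h : (D u y).1 = m
    · simp only [h, ne_eq, not_true_eq_false, if_false]
      split_ifs <;> norm_num
    · have : D u y ≠ (m, l) := fun h' => h (by rw [h'])
      simp [h, this]
  have hs : ∀ s, ∑ y, RS s * N (u (m, l u m s)) s y * (if (D u y).1 ≠ m then 1 else 0) ≤
      cov u m s + (1 / (L : ℝ)) * ∑ l, TS (u (m, l)) s * e u m s l := by
    intro s
    have h1 : ∑ y, RS s * N (u (m, l u m s)) s y * (if (D u y).1 ≠ m then 1 else 0) =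
        RS s * e u m s (l u m s) := by
      simp only [e, Finset.mul_sum, mul_assoc]
    have h2 : (∑ k ∈ B m, TS (u k) s) / (B m).card = (1 / (L : ℝ)) * ∑ l, TS (u (m, l)) s := by
      rw [hBcard, one_div_mul_eq_div]
      simp [B]
    have h3 : (1 / (L : ℝ)) * (∑ l, TS (u (m, l)) s) * e u m s (l u m s) ≤
        (1 / (L : ℝ)) * ∑ l, TS (u (m, l)) s * e u m s l := by
      rw [mul_assoc, Finset.sum_mul]
      exact mul_le_mul_of_nonneg_left (Finset.sum_le_sum fun l' _ =>
        mul_le_mul_of_nonneg_left (hl u m s l') (hTS _ _)) (by positivity)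
    have h4 : (RS s - (1 / (L : ℝ)) * ∑ l, TS (u (m, l)) s) * e u m s (l u m s) ≤
        cov u m s := by
      simp only [cov, h2]
      exact (mul_le_mul_of_nonneg_right (le_max_left _ 0) (he0 _ _ _ _)).trans
        (mul_le_of_le_one_right (le_max_right _ _) (he1 _ _ _ _))
    rw [h1]
    linarith
  refine (Finset.sum_le_sum fun s _ => hs s).trans ?_
  rw [Finset.sum_add_distrib, ← Finset.mul_sum, Finset.sum_comm]
  gcongr
  exact hTYe _

end OneShot

section Chernoff

lemma exists_sum_mul_exp_lt_one {Ω : Type*} [Fintype Ω] {Q : Ω → ℝ} (hQ : ∑ ω, Q ω = 1)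
    (X : Ω → ℝ) (hX : ∑ ω, Q ω * X ω < 0) : ∃ t > 0, ∑ ω, Q ω * Real.exp (t * X ω) < 1 := by
  have hd : HasDerivAt (fun t => ∑ ω, Q ω * Real.exp (t * X ω)) (∑ ω, Q ω * X ω) 0 := by
    refine HasDerivAt.fun_sum fun ω _ => ?_
    have h := (((hasDerivAt_id (0 : ℝ)).mul_const (X ω)).exp).const_mul (Q ω)
    simpa using h
  have ht := hd.tendsto_slope_zero_right
  obtain ⟨t, hlt, ht0⟩ := ((ht.eventually_lt_const hX).and self_mem_nhdsWithin).exists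
  refine ⟨t, ht0, ?_⟩
  have ht0' : 0 < t := ht0
  simp only [zero_add, zero_mul, Real.exp_zero, mul_one, hQ, smul_eq_mul] at hlt
  have := (inv_mul_lt_iff₀ ht0').mp hlt
  linarith

/-- Chernoff bound for sums of i.i.d. variables with a finite range. -/
lemma exists_tail_le_pow {Ω : Type*} [Fintype Ω] {Q : Ω → ℝ} (hQ0 : ∀ ω, 0 ≤ Q ω)
    (hQ : ∑ ω, Q ω = 1) (X : Ω → ℝ) {a : ℝ} (ha : ∑ ω, Q ω * X ω < a) :
    ∃ ρ, 0 ≤ ρ ∧ ρ < 1 ∧ ∀ n : ℕ,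
      ∑ w : Fin n → Ω, (∏ i, Q (w i)) * (if n * a ≤ ∑ i, X (w i) then 1 else 0) ≤ ρ ^ n := by
  obtain ⟨t, ht, hlt⟩ := exists_sum_mul_exp_lt_one hQ (fun ω => X ω - a) (by
    simp only [mul_sub, Finset.sum_sub_distrib, ← Finset.sum_mul, hQ]
    linarith)
  refine ⟨_, Finset.sum_nonneg fun ω _ => mul_nonneg (hQ0 ω) (Real.exp_pos _).le, hlt,
    fun n => ?_⟩
  calc _ ≤ ∑ w : Fin n → Ω, ∏ i, (Q (w i) * Real.exp (t * (X (w i) - a))) := by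
        refine Finset.sum_le_sum fun w _ => ?_
        rw [Finset.prod_mul_distrib, ← Real.exp_sum, ← Finset.mul_sum, Finset.sum_sub_distrib]
        refine mul_le_mul_of_nonneg_left ?_ (Finset.prod_nonneg fun i _ => hQ0 _)
        split_ifs with h
        · refine Real.one_le_exp (mul_nonneg ht.le ?_)
          simpa using h
        · exact (Real.exp_pos _).le
    _ = _ := by
        rw [← Fintype.prod_sum fun (_ : Fin n) ω => Q ω * Real.exp (t * (X ω - a))]
        simp

end Chernoff

section Information

lemma pushPMF_nonneg {Ω γ : Type*} [Fintype Ω] [DecidableEq γ] {p : Ω → ℝ}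
    (hp : ∀ ω, 0 ≤ p ω) (A : Ω → γ) (c : γ) : 0 ≤ pushPMF p A c :=
  Finset.sum_nonneg fun ω _ => by split_ifs <;> simp [hp]

lemma pushPMF_fst_eq_sum {Ω α β : Type*} [Fintype Ω] [Fintype β] [DecidableEq α]
    [DecidableEq β] (p : Ω → ℝ) (A : Ω → α) (B : Ω → β) (a : α) :
    pushPMF p A a = ∑ b, pushPMF p (fun ω => (A ω, B ω)) (a, b) := by
  simp only [pushPMF, Prod.mk.injEq]
  rw [Finset.sum_comm]
  refine Finset.sum_congr rfl fun ω _ => ?_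
  by_cases h : A ω = a <;> simp [h]

variable {α β : Type*} [Fintype β]

/-- The channel from the first to the second component of a joint pmf. -/
def channel (Q : α → β → ℝ) (a : α) (b : β) : ℝ := Q a b / ∑ b', Q a b'

variable {Q : α → β → ℝ}

lemma channel_nonneg (hQ0 : ∀ a b, 0 ≤ Q a b) (a : α) (b : β) : 0 ≤ channel Q a b :=
  div_nonneg (hQ0 a b) (Finset.sum_nonneg fun _ _ => hQ0 _ _)

lemma sum_mul_channel (hQ0 : ∀ a b, 0 ≤ Q a b) (a : α) (b : β) :
    (∑ b', Q a b') * channel Q a b = Q a b := by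
  by_cases h : ∑ b', Q a b' = 0
  · rw [h, zero_mul]
    exact ((Finset.sum_eq_zero_iff_of_nonneg fun b _ => hQ0 a b).mp h b (Finset.mem_univ b)).symm
  · exact mul_div_cancel₀ _ h

lemma sum_fst_pos (hQ0 : ∀ a b, 0 ≤ Q a b) {a : α} {b : β} (h : 0 < Q a b) :
    0 < ∑ b', Q a b' :=
  h.trans_le (Finset.single_le_sum (fun b _ => hQ0 a b) (Finset.mem_univ b))

lemma sum_snd_pos {α β : Type*} [Fintype α] {Q : α → β → ℝ} (hQ0 : ∀ a b, 0 ≤ Q a b) {a : α}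
    {b : β} (h : 0 < Q a b) : 0 < ∑ a', Q a' b :=
  h.trans_le (Finset.single_le_sum (f := fun a => Q a b) (fun a _ => hQ0 a b)
    (Finset.mem_univ a))

lemma prod_sum_mul_prod_channel (hQ0 : ∀ a b, 0 ≤ Q a b) {n : ℕ} (v : Fin n → α)
    (y : Fin n → β) :
    (∏ i, ∑ b, Q (v i) b) * ∏ i, channel Q (v i) (y i) = ∏ i, Q (v i) (y i) := by
  rw [← Finset.prod_mul_distrib]
  exact Finset.prod_congr rfl fun i _ => sum_mul_channel hQ0 _ _

variable [Fintype α]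

/-- The information density, in nats. -/
def infoDensity (Q : α → β → ℝ) (a : α) (b : β) : ℝ :=
  Real.log (channel Q a b / ∑ a', Q a' b)

/-- The mutual information of the two components, in nats. -/
def natInfo (Q : α → β → ℝ) : ℝ := ∑ a, ∑ b, Q a b * infoDensity Q a b

lemma channel_eq_zero (hQ0 : ∀ a b, 0 ≤ Q a b) {b : β} (h : ∑ a, Q a b = 0) (a : α) :
    channel Q a b = 0 := by
  rw [channel, (Finset.sum_eq_zero_iff_of_nonneg fun a _ => hQ0 a b).mp h a (Finset.mem_univ a),
    zero_div]

lemma natInfo_nonneg (hQ0 : ∀ a b, 0 ≤ Q a b) (hQ : ∑ a, ∑ b, Q a b = 1) : 0 ≤ natInfo Q := by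
  have hpt : ∀ a b, Q a b - (∑ b', Q a b') * ∑ a', Q a' b ≤ Q a b * infoDensity Q a b := by
    intro a b
    rcases (hQ0 a b).eq_or_lt with h | h
    · rw [← h]
      have := mul_nonneg (Finset.sum_nonneg fun b' (_ : b' ∈ Finset.univ) => hQ0 a b')
        (Finset.sum_nonneg fun a' (_ : a' ∈ Finset.univ) => hQ0 a' b)
      linarith
    · have h1 := sum_fst_pos hQ0 h
      have h2 := sum_snd_pos hQ0 h
      have h3 : 0 < channel Q a b / ∑ a', Q a' b := div_pos (div_pos h h1) h2
      have h4 := Real.one_sub_inv_le_log_of_pos h3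
      calc _ = Q a b * (1 - (channel Q a b / ∑ a', Q a' b)⁻¹) := by
            rw [channel]; field_simp
        _ ≤ _ := mul_le_mul_of_nonneg_left h4 h.le
  have hsum : ∑ a, ∑ b, (Q a b - (∑ b', Q a b') * ∑ a', Q a' b) = 0 := by
    simp_rw [Finset.sum_sub_distrib]
    rw [← Finset.sum_mul_sum, hQ, Finset.sum_comm, hQ]
    norm_num
  rw [← hsum]
  exact Finset.sum_le_sum fun a _ => Finset.sum_le_sum fun b _ => hpt a b

lemma log_prod_channel_div {n : ℕ} (hQ0 : ∀ a b, 0 ≤ Q a b) {v : Fin n → α} {y : Fin n → β}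
    (h : ∀ i, 0 < Q (v i) (y i)) :
    Real.log (∏ i, channel Q (v i) (y i)) =
      Real.log (∏ i, ∑ a, Q a (y i)) + ∑ i, infoDensity Q (v i) (y i) := by
  have h1 := fun i => sum_fst_pos hQ0 (h i)
  have h2 := fun i => sum_snd_pos hQ0 (h i)
  have h3 : ∀ i, 0 < channel Q (v i) (y i) := fun i => div_pos (h i) (h1 i)
  rw [Real.log_prod fun i _ => (h3 i).ne', Real.log_prod fun i _ => (h2 i).ne',
    ← Finset.sum_add_distrib]
  refine Finset.sum_congr rfl fun i _ => ?_
  rw [infoDensity, Real.log_div (h3 i).ne' (h2 i).ne']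
  ring

lemma exists_sum_pi_tail_le_pow (hQ0 : ∀ a b, 0 ≤ Q a b) (hQ : ∑ a, ∑ b, Q a b = 1)
    (X : α → β → ℝ) {a : ℝ} (ha : ∑ v, ∑ y, Q v y * X v y < a) :
    ∃ ρ, 0 ≤ ρ ∧ ρ < 1 ∧ ∀ n : ℕ, ∑ v : Fin n → α, ∑ y : Fin n → β,
      (∏ i, Q (v i) (y i)) * (if n * a ≤ ∑ i, X (v i) (y i) then 1 else 0) ≤ ρ ^ n := by
  obtain ⟨ρ, h0, h1, h⟩ := exists_tail_le_pow (Q := fun ω : α × β => Q ω.1 ω.2)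
    (fun ω => hQ0 _ _) (by rw [Fintype.sum_prod_type]; exact hQ) (fun ω => X ω.1 ω.2)
    (by rw [Fintype.sum_prod_type]; exact ha)
  refine ⟨ρ, h0, h1, fun n => le_of_eq_of_le ?_ (h n)⟩
  rw [← Fintype.sum_prod_type', ← (Equiv.arrowProdEquivProdArrow (Fin n) (fun _ => α)
    (fun _ => β)).sum_comp]
  rfl

/-- The `n`-fold information density exceeds `n * a` with exponentially small probability when
`a` exceeds the mutual information. -/
lemma exists_upper_tail_le_pow (hQ0 : ∀ a b, 0 ≤ Q a b) (hQ : ∑ a, ∑ b, Q a b = 1) {a : ℝ}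
    (ha : natInfo Q < a) :
    ∃ ρ, 0 ≤ ρ ∧ ρ < 1 ∧ ∀ n : ℕ, ∑ v : Fin n → α, ∑ y : Fin n → β,
      (∏ i, ∑ b, Q (v i) b) * (∏ i, channel Q (v i) (y i)) *
        (if Real.exp (n * a) * (∏ i, ∑ a, Q a (y i)) < ∏ i, channel Q (v i) (y i)
          then 1 else 0) ≤ ρ ^ n := by
  obtain ⟨ρ, h0, h1, h⟩ := exists_sum_pi_tail_le_pow hQ0 hQ (infoDensity Q) ha
  refine ⟨ρ, h0, h1, fun n => le_trans (Finset.sum_le_sum fun v _ =>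
    Finset.sum_le_sum fun y _ => ?_) (h n)⟩
  rw [prod_sum_mul_prod_channel hQ0]
  by_cases hpos : ∀ i, 0 < Q (v i) (y i)
  · refine mul_le_mul_of_nonneg_left ?_ (Finset.prod_nonneg fun i _ => hQ0 _ _)
    have hR : 0 < ∏ i, ∑ a, Q a (y i) := Finset.prod_pos fun i _ => sum_snd_pos hQ0 (hpos i)
    split_ifs with hlt hle
    · exact le_rfl
    · have hlog := Real.log_lt_log (mul_pos (Real.exp_pos _) hR) hlt
      rw [Real.log_mul (Real.exp_pos _).ne' hR.ne', Real.log_exp,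
        log_prod_channel_div hQ0 hpos] at hlog
      exact absurd (by linarith) hle
    · exact zero_le_one
    · exact le_rfl
  · push Not at hpos
    obtain ⟨i, hi⟩ := hpos
    rw [Finset.prod_eq_zero (Finset.mem_univ i) (le_antisymm hi (hQ0 _ _)), zero_mul, zero_mul]

/-- The `n`-fold information density falls below `n * a` with exponentially small probability
when `a` is less than the mutual information. -/
lemma exists_lower_tail_le_pow (hQ0 : ∀ a b, 0 ≤ Q a b) (hQ : ∑ a, ∑ b, Q a b = 1) {a : ℝ}
    (ha : a < natInfo Q) :
    ∃ ρ, 0 ≤ ρ ∧ ρ < 1 ∧ ∀ n : ℕ, ∑ v : Fin n → α, ∑ y : Fin n → β,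
      (∏ i, ∑ b, Q (v i) b) * (∏ i, channel Q (v i) (y i)) *
        (if ∏ i, channel Q (v i) (y i) < Real.exp (n * a) * (∏ i, ∑ a, Q a (y i))
          then 1 else 0) ≤ ρ ^ n := by
  obtain ⟨ρ, h0, h1, h⟩ := exists_sum_pi_tail_le_pow hQ0 hQ (fun v y => -infoDensity Q v y)
    (a := -a) (by simpa only [natInfo, mul_neg, Finset.sum_neg_distrib, neg_lt_neg_iff] using ha)
  refine ⟨ρ, h0, h1, fun n => le_trans (Finset.sum_le_sum fun v _ =>
    Finset.sum_le_sum fun y _ => ?_) (h n)⟩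
  rw [prod_sum_mul_prod_channel hQ0]
  by_cases hpos : ∀ i, 0 < Q (v i) (y i)
  · refine mul_le_mul_of_nonneg_left ?_ (Finset.prod_nonneg fun i _ => hQ0 _ _)
    have hR : 0 < ∏ i, ∑ a, Q a (y i) := Finset.prod_pos fun i _ => sum_snd_pos hQ0 (hpos i)
    have hT : 0 < ∏ i, channel Q (v i) (y i) :=
      Finset.prod_pos fun i _ => div_pos (hpos i) (sum_fst_pos hQ0 (hpos i))
    split_ifs with hlt hle
    · exact le_rfl
    · have hlog := Real.log_lt_log hT hlt
      rw [Real.log_mul (Real.exp_pos _).ne' hR.ne', Real.log_exp,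
        log_prod_channel_div hQ0 hpos] at hlog
      rw [Finset.sum_neg_distrib] at hle
      exact absurd (by linarith) hle
    · exact zero_le_one
    · exact le_rfl
  · push Not at hpos
    obtain ⟨i, hi⟩ := hpos
    rw [Finset.prod_eq_zero (Finset.mem_univ i) (le_antisymm hi (hQ0 _ _)), zero_mul, zero_mul]

lemma mutInfoOf_eq_natInfo_div {Ω : Type*} [Fintype Ω] [DecidableEq α] [DecidableEq β]
    {p : Ω → ℝ} (hp : ∀ ω, 0 ≤ p ω) (A : Ω → α) (B : Ω → β) :
    mutInfoOf p A B =
      natInfo (fun a b => pushPMF p (fun ω => (A ω, B ω)) (a, b)) / Real.log 2 := by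
  set Q : α → β → ℝ := fun a b => pushPMF p (fun ω => (A ω, B ω)) (a, b) with hQ
  have hQ0 : ∀ a b, 0 ≤ Q a b := fun a b => pushPMF_nonneg hp _ _
  have hA : ∀ a, pushPMF p A a = ∑ b, Q a b := pushPMF_fst_eq_sum p A B
  have hterm : ∀ a b, Q a b * infoDensity Q a b / Real.log 2 =
      Q a b * Real.logb 2 (Q a b / ∑ a', Q a' b) - Q a b * Real.logb 2 (∑ b', Q a b') := by
    intro a b
    rcases (hQ0 a b).eq_or_lt with h | h
    · simp [← h]
    · have h1 := sum_fst_pos hQ0 h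
      have h2 := sum_snd_pos hQ0 h
      rw [infoDensity, channel, div_right_comm, Real.log_div (div_pos h h2).ne' h1.ne',
        Real.logb, Real.logb]
      ring
  simp only [mutInfoOf, entOf, condEntOf, ent, condEnt, margSnd, natInfo, Finset.sum_div, hterm,
    Finset.sum_sub_distrib, hA, ← Finset.sum_mul]
  simp only [hQ]
  ring

lemma sum_prod_mul_prod_channel (hQ0 : ∀ a b, 0 ≤ Q a b) {n : ℕ} (y : Fin n → β) :
    ∑ v : Fin n → α, (∏ i, ∑ b, Q (v i) b) * ∏ i, channel Q (v i) (y i) =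
      ∏ i, ∑ a, Q a (y i) := by
  simp_rw [prod_sum_mul_prod_channel hQ0]
  rw [Fintype.prod_sum fun (i : Fin n) a => Q a (y i)]

end Information

/-- Every geometric decay is eventually faster than `2 ^ (-n ^ b)` with `b < 1`. -/
lemma eventually_mul_pow_le_two_rpow {ρ b : ℝ} (hρ0 : 0 < ρ) (hρ1 : ρ < 1) (hb : b < 1) {C : ℝ}
    (hC : 0 < C) :
    ∀ᶠ n : ℕ in Filter.atTop, C * ρ ^ n ≤ (2 : ℝ) ^ (-((n : ℝ) ^ b)) := by
  have hlim : Filter.Tendsto (fun x : ℝ => Real.log C * x⁻¹ + Real.log 2 * x ^ (-(1 - b)))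
      Filter.atTop (nhds 0) := by
    simpa using (tendsto_inv_atTop_zero.const_mul (Real.log C)).add
      ((tendsto_rpow_neg_atTop (sub_pos.mpr hb)).const_mul (Real.log 2))
  have hev := (hlim.eventually_lt_const (neg_pos.mpr (Real.log_neg hρ0 hρ1))).and
    (Filter.eventually_gt_atTop 0)
  filter_upwards [tendsto_natCast_atTop_atTop.eventually hev] with n hn
  obtain ⟨hn, hpos⟩ := hn
  rw [← Real.log_le_log_iff (by positivity) (by positivity), Real.log_mul hC.ne' (by positivity),
    Real.log_pow, Real.log_rpow two_pos]
  have h := mul_lt_mul_of_pos_right hn hpos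
  have hrpow : (n : ℝ) ^ (-(1 - b)) * n = (n : ℝ) ^ b := by
    conv_lhs => rw [← Real.rpow_one (n : ℝ), ← Real.rpow_mul hpos.le, ← Real.rpow_add hpos]
    congr 1
    ring
  rw [add_mul, mul_assoc, mul_assoc, inv_mul_cancel₀ hpos.ne', hrpow] at h
  linarith

/-- Achievability for memoryless coding with noncausal state, with exponentially small error
probability. -/
lemma exists_code {α Xc Sc Yc : Type*} [Fintype α] [Fintype Xc] [Fintype Sc] [Fintype Yc]
    (W : Xc → Sc → Yc → ℝ) (hW : ∀ x s, IsPMF (W x s)) (f : α → Sc → Xc)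
    {QS : α → Sc → ℝ} {QY : α → Yc → ℝ} (hQS0 : ∀ v s, 0 ≤ QS v s)
    (hQS : ∑ v, ∑ s, QS v s = 1) (hQY : ∀ v y, QY v y = ∑ s, QS v s * W (f v s) s y)
    {ε : ℝ} (hε : 0 < ε) (hgap : 5 * ε ≤ natInfo QY - natInfo QS) :
    ∃ ρ, 0 < ρ ∧ ρ < 1 ∧ ∀ n : ℕ, ∃ (M : ℕ)
      (enc : Fin M → (Fin n → Sc) → Fin n → Xc) (dec : (Fin n → Yc) → Fin M),
      0 < M ∧ n * (natInfo QY - natInfo QS - 5 * ε) ≤ Real.log M ∧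
      PeGP (fun s => ∑ v, QS v s) W enc dec ≤ 7 * ρ ^ n := by
  have hQY0 : ∀ v y, 0 ≤ QY v y := fun v y => by
    rw [hQY]; exact Finset.sum_nonneg fun s _ => mul_nonneg (hQS0 v s) ((hW _ _).1 y)
  have hmarg : ∀ v, ∑ y, QY v y = ∑ s, QS v s := fun v => by
    simp_rw [hQY]
    rw [Finset.sum_comm]
    simp_rw [← Finset.mul_sum, (hW _ _).2, mul_one]
  have hQY1 : ∑ v, ∑ y, QY v y = 1 := by simp_rw [hmarg, hQS]
  have hchan : ∀ v y, channel QY v y = ∑ s, channel QS v s * W (f v s) s y := fun v y => by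
    simp only [channel, hmarg]
    rw [hQY, Finset.sum_div]
    exact Finset.sum_congr rfl fun s _ => by ring
  obtain ⟨ρ₁, h10, h11, h1⟩ := exists_upper_tail_le_pow hQS0 hQS (lt_add_of_pos_right _ hε)
  obtain ⟨ρ₂, h20, h21, h2⟩ := exists_lower_tail_le_pow hQY0 hQY1 (sub_lt_self _ hε)
  simp_rw [hmarg] at h2
  have hr1 : Real.exp (-(ε / 2)) < 1 := Real.exp_lt_one_iff.mpr (by linarith)
  refine ⟨max (max ρ₁ ρ₂) (Real.exp (-(ε / 2))), lt_max_of_lt_right (Real.exp_pos _),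
    max_lt (max_lt h11 h21) hr1, fun n => ?_⟩
  set ρ := max (max ρ₁ ρ₂) (Real.exp (-(ε / 2))) with hρ
  have hn : (0 : ℝ) ≤ n := n.cast_nonneg
  have hIS := natInfo_nonneg hQS0 hQS
  let M := ⌈Real.exp (n * (natInfo QY - natInfo QS - 5 * ε))⌉₊
  let L := ⌈Real.exp (n * (natInfo QS + 2 * ε))⌉₊
  have hM : 0 < M := Nat.ceil_pos.mpr (Real.exp_pos _)
  have hL : 0 < L := Nat.ceil_pos.mpr (Real.exp_pos _)
  have hMlow : Real.exp (n * (natInfo QY - natInfo QS - 5 * ε)) ≤ M := Nat.le_ceil _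
  have hLlow : Real.exp (n * (natInfo QS + 2 * ε)) ≤ L := Nat.le_ceil _
  have hceil : ∀ x : ℝ, 0 ≤ x → (⌈Real.exp x⌉₊ : ℝ) ≤ 2 * Real.exp x := fun x hx => by
    have := Nat.ceil_lt_add_one (Real.exp_pos x).le
    have := Real.one_le_exp hx
    linarith
  have hMup : (M : ℝ) ≤ 2 * Real.exp (n * (natInfo QY - natInfo QS - 5 * ε)) :=
    hceil _ (mul_nonneg hn (by linarith))
  have hLup : (L : ℝ) ≤ 2 * Real.exp (n * (natInfo QS + 2 * ε)) :=
    hceil _ (mul_nonneg hn (by linarith))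
  have hexp : Real.exp (-(n * (ε / 2))) ≤ ρ ^ n := by
    rw [← mul_neg, Real.exp_nat_mul]
    exact pow_le_pow_left₀ (Real.exp_pos _).le (le_max_right _ _) n
  have hsqrt : √(Real.exp (n * (natInfo QS + ε)) / L) ≤ ρ ^ n := by
    refine le_trans (Real.sqrt_le_iff.mpr ⟨(Real.exp_pos _).le, ?_⟩) hexp
    rw [div_le_iff₀ (by exact_mod_cast hL)]
    calc Real.exp (n * (natInfo QS + ε))
        = Real.exp (-(n * (ε / 2))) ^ 2 * Real.exp (n * (natInfo QS + 2 * ε)) := by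
          rw [← Real.exp_nat_mul, ← Real.exp_add]
          congr 1
          push_cast
          ring
      _ ≤ _ := mul_le_mul_of_nonneg_left hLlow (sq_nonneg _)
  have hcode : M * L / Real.exp (n * (natInfo QY - ε)) ≤ 4 * ρ ^ n := by
    rw [div_le_iff₀ (Real.exp_pos _)]
    calc (M : ℝ) * L ≤ (2 * Real.exp (n * (natInfo QY - natInfo QS - 5 * ε))) *
          (2 * Real.exp (n * (natInfo QS + 2 * ε))) :=
          mul_le_mul hMup hLup (Nat.cast_nonneg _) (by positivity)
      _ = 4 * Real.exp (n * (natInfo QY - 3 * ε)) := by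
          rw [mul_mul_mul_comm, ← Real.exp_add]
          norm_num
          ring
      _ ≤ 4 * (Real.exp (-(n * (ε / 2))) * Real.exp (n * (natInfo QY - ε))) := by
          rw [← Real.exp_add]
          gcongr
          nlinarith [mul_nonneg hn hε.le]
      _ ≤ _ := by
          rw [mul_assoc]
          gcongr
  obtain ⟨enc, dec, hpe⟩ := exists_code_one_shot (α := Fin n → α) (β := Fin n → Yc)
    (σ := Fin n → Sc) (P := fun v => ∏ i, ∑ s, QS (v i) s) hM hL
    (N := fun v s y => ∏ i, W (f (v i) (s i)) (s i) (y i))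
    (TS := fun v s => ∏ i, channel QS (v i) (s i))
    (TY := fun v y => ∏ i, channel QY (v i) (y i))
    (RS := fun s => ∏ i, ∑ v, QS v (s i)) (RY := fun y => ∏ i, ∑ v, QY v (y i))
    (fun v => Finset.prod_nonneg fun i _ => Finset.sum_nonneg fun s _ => hQS0 _ _)
    (by rw [← Fintype.prod_sum fun (_ : Fin n) v => ∑ s, QS v s]; simp [hQS])
    (fun v s y => Finset.prod_nonneg fun i _ => (hW _ _).1 _)
    (fun v s => by
      rw [← Fintype.prod_sum fun (i : Fin n) y => W (f (v i) (s i)) (s i) y]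
      simp [(hW _ _).2])
    (fun v s => Finset.prod_nonneg fun i _ => channel_nonneg hQS0 _ _)
    (fun s => (sum_prod_mul_prod_channel hQS0 s).symm)
    (by
      rw [← Fintype.prod_sum fun (_ : Fin n) s => ∑ v, QS v s, Finset.sum_comm]
      simp [hQS])
    (fun v y => by
      simp_rw [hchan, ← Finset.prod_mul_distrib]
      rw [Fintype.prod_sum fun (i : Fin n) s => channel QS (v i) s * W (f (v i) s) s (y i)])
    (fun y => by
      rw [← sum_prod_mul_prod_channel hQY0 y]
      simp_rw [hmarg])
    (by
      rw [← Fintype.prod_sum fun (_ : Fin n) y => ∑ v, QY v y, Finset.sum_comm]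
      simp [hQY1])
    (fun y hy v => by
      obtain ⟨i, -, hi⟩ := Finset.prod_eq_zero_iff.mp hy
      exact Finset.prod_eq_zero (Finset.mem_univ i) (channel_eq_zero hQY0 hi _))
    (Real.exp_pos (n * (natInfo QS + ε))).le (Real.exp_pos (n * (natInfo QY - ε)))
  refine ⟨M, fun m s i => f (enc m s i) (s i), dec, hM, ?_, ?_⟩
  · rw [← Real.log_exp (n * (natInfo QY - natInfo QS - 5 * ε))]
    exact Real.log_le_log (Real.exp_pos _) hMlow
  · have hp1 : ρ₁ ^ n ≤ ρ ^ n :=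
      pow_le_pow_left₀ h10 ((le_max_left _ _).trans (le_max_left _ _)) n
    have hp2 : ρ₂ ^ n ≤ ρ ^ n :=
      pow_le_pow_left₀ h20 ((le_max_right _ _).trans (le_max_left _ _)) n
    have := h1 n
    have := h2 n
    exact hpe.trans (by linarith)

end GelfandPinsker

/-- polar codes achieve the Gelfand–Pinsker rate: for a binary
auxiliary `V` with conditional pmf `P_{V|S}` and input `X = f(V,S)`, if
`I(V;Y) − I(V;S) > 0` then for every δ > 0 there is an (M,n) code with rate at least
`I(V;Y) − I(V;S) − δ` and error probability at most `2^{-n^β}`. -/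
theorem gelfand_pinsker_polar_achievable
    {Xc Sc Yc : Type*} [Fintype Xc] [Fintype Sc] [Fintype Yc]
    [DecidableEq Sc] [DecidableEq Yc]
    (PS : Sc → ℝ) (hPS : IsPMF PS)
    (W : Xc → Sc → Yc → ℝ) (hW : ∀ x s, IsPMF (W x s))
    (PV : Sc → ZMod 2 → ℝ) (hPV : ∀ s, IsPMF (PV s))
    (f : ZMod 2 → Sc → Xc)
    (q : (ZMod 2 × Sc) × Yc → ℝ)
    (hq : q = fun ω => PS ω.1.2 * PV ω.1.2 ω.1.1 * W (f ω.1.1 ω.1.2) ω.1.2 ω.2)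
    (hpos : 0 < mutInfoOf q (fun ω => ω.1.1) (fun ω => ω.2)
        - mutInfoOf q (fun ω => ω.1.1) (fun ω => ω.1.2))
    (b : ℝ) (hb0 : 0 < b) (hb : b < 1 / 2) :
    ∀ δ > 0, ∃ (n M : ℕ)
      (enc : Fin M → (Fin n → Sc) → Fin n → Xc) (dec : (Fin n → Yc) → Fin M),
      0 < n ∧ 0 < M ∧
      mutInfoOf q (fun ω => ω.1.1) (fun ω => ω.2)
          - mutInfoOf q (fun ω => ω.1.1) (fun ω => ω.1.2) - δ
        ≤ Real.logb 2 M / n ∧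
      PeGP PS W enc dec ≤ Real.rpow 2 (-(Real.rpow (n : ℝ) b)) := by
  intro δ hδ
  subst hq
  set q : (ZMod 2 × Sc) × Yc → ℝ :=
    fun ω => PS ω.1.2 * PV ω.1.2 ω.1.1 * W (f ω.1.1 ω.1.2) ω.1.2 ω.2 with hq
  have hq0 : ∀ ω, 0 ≤ q ω := fun ω =>
    mul_nonneg (mul_nonneg (hPS.1 _) ((hPV _).1 _)) ((hW _ _).1 _)
  set QS : ZMod 2 → Sc → ℝ := fun v s => PS s * PV s v with hQS
  set QY : ZMod 2 → Yc → ℝ := fun v y => ∑ s, QS v s * W (f v s) s y with hQY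
  have hpushS : (fun v s => pushPMF q (fun ω => (ω.1.1, ω.1.2)) (v, s)) = QS := by
    funext v s
    simp only [pushPMF, Prod.mk.eta, Fintype.sum_prod_type_right, Finset.sum_ite_eq',
      Finset.mem_univ, if_true, hq, ← Finset.mul_sum, (hW _ _).2, mul_one, hQS]
  have hpushY : (fun v y => pushPMF q (fun ω => (ω.1.1, ω.2)) (v, y)) = QY := by
    funext v y
    simp [pushPMF, Fintype.sum_prod_type, ite_and, hq, hQS, hQY]
  have hlog2 : 0 < Real.log 2 := Real.log_pos one_lt_two
  have hrate : mutInfoOf q (fun ω => ω.1.1) (fun ω => ω.2)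
      - mutInfoOf q (fun ω => ω.1.1) (fun ω => ω.1.2) =
      (GelfandPinsker.natInfo QY - GelfandPinsker.natInfo QS) / Real.log 2 := by
    rw [GelfandPinsker.mutInfoOf_eq_natInfo_div hq0, GelfandPinsker.mutInfoOf_eq_natInfo_div hq0,
      hpushS, hpushY, sub_div]
  rw [hrate] at hpos ⊢
  have hgap := (div_pos_iff_of_pos_right hlog2).mp hpos
  have hmarg : (fun s => ∑ v, QS v s) = PS := by
    funext s
    simp [hQS, ← Finset.mul_sum, (hPV s).2]
  have hQS1 : ∑ v, ∑ s, QS v s = 1 := by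
    rw [Finset.sum_comm]
    exact (Finset.sum_congr rfl fun s _ => congrFun hmarg s).trans hPS.2
  set ε := min (GelfandPinsker.natInfo QY - GelfandPinsker.natInfo QS) (δ * Real.log 2) / 5
    with hε
  have hε0 : 0 < ε := div_pos (lt_min hgap (mul_pos hδ hlog2)) (by norm_num)
  have hε1 : 5 * ε ≤ GelfandPinsker.natInfo QY - GelfandPinsker.natInfo QS := by
    rw [hε, mul_div_cancel₀ _ (by norm_num)]
    exact min_le_left _ _
  have hε2 : 5 * ε ≤ δ * Real.log 2 := by
    rw [hε, mul_div_cancel₀ _ (by norm_num)]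
    exact min_le_right _ _
  obtain ⟨ρ, hρ0, hρ1, hcode⟩ := GelfandPinsker.exists_code W hW f
    (fun v s => mul_nonneg (hPS.1 s) ((hPV s).1 v)) hQS1 (fun v y => rfl) hε0 hε1
  obtain ⟨n, hn, hn0⟩ := ((GelfandPinsker.eventually_mul_pow_le_two_rpow hρ0 hρ1
    (hb.trans one_half_lt_one) (C := 7) (by norm_num)).and (Filter.eventually_gt_atTop 0)).exists
  obtain ⟨M, enc, dec, hM, hMrate, hpe⟩ := hcode n
  rw [hmarg] at hpe
  refine ⟨n, M, enc, dec, hn0, hM, ?_, hpe.trans hn⟩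
  have hn' : (0 : ℝ) < n := by exact_mod_cast hn0
  rw [Real.logb, div_right_comm, le_div_iff₀ hlog2, sub_mul, div_mul_cancel₀ _ hlog2.ne',
    le_div_iff₀ hn']
  refine le_trans ?_ hMrate
  rw [mul_comm]
  exact mul_le_mul_of_nonneg_left (by linarith) hn'.le
end
end
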